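/- Let G_A ∈ ℂ^{N_A×N_R}, G_B ∈ ℂ^{N_B×N_R}, H_A ∈ ℂ^{N_R×N_A}, H_B ∈ ℂ^{N_R×N_B} be complex matrices and q_A ∈ ℂ^{N_A}, q_B ∈ ℂ^{N_B} vectors with H_A q_A ≠ 0 and H_B q_B ≠ 0. Let V be a matrix with orthonormal columns whose column space equals the column space of the block matrix [G_Aᴴ G_Bᴴ]. For relay matrices F_A, F_B ∈ ℂ^{N_R×N_R}, define the relay power P(F_A,F_B) = Tr(F_A H_A q_A q_Aᴴ H_Aᴴ F_Aᴴ + F_B H_B q_B q_Bᴴ H_Bᴴ F_Bᴴ + F_A F_Aᴴ + F_B F_Bᴴ) and the SINR terms x_{BA}(F_A,F_B) = q_Bᴴ H_Bᴴ F_Bᴴ G_Aᴴ (G_A (F_A F_Aᴴ + F_B F_Bᴴ) G_Aᴴ + I)⁻¹ G_A F_B H_B q_B and x_{AB}(F_A,F_B) = q_Aᴴ H_Aᴴ F_Aᴴ G_Bᴴ (G_B (F_A F_Aᴴ + F_B F_Bᴴ) G_Bᴴ + I)⁻¹ G_B F_A H_A q_A. Then for every pair (F_A, F_B) there exist vectors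 a₁, a₂ (with length equal to the number of columns of V) such that the structured matrices F_A' = V a₁ (H_A q_A)ᴴ/‖H_A q_A‖ and F_B' = V a₂ (H_B q_B)ᴴ/‖H_B q_B‖ satisfy P(F_A', F_B') ≤ P(F_A, F_B), x_{BA}(F_A', F_B') ≥ x_{BA}(F_A, F_B), and x_{AB}(F_A', F_B') ≥ x_{AB}(F_A, F_B). -/

import Mathlib

open Matrix

/-- The Euclidean (ℓ²) norm of a complex vector. -/
noncomputable def evnorm {m : ℕ} (v : Fin m → ℂ) : ℝ :=
  Real.sqrt (∑ i, ‖v i‖ ^ 2)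

/-- The relay transmit power
`Tr(F_A H_A q_A q_Aᴴ H_Aᴴ F_Aᴴ + F_B H_B q_B q_Bᴴ H_Bᴴ F_Bᴴ + F_A F_Aᴴ + F_B F_Bᴴ)`
of the three-phase scheme. -/
noncomputable def relayPower3P {NA NB NR : ℕ}
    (HA : Matrix (Fin NR) (Fin NA) ℂ) (HB : Matrix (Fin NR) (Fin NB) ℂ)
    (qA : Fin NA → ℂ) (qB : Fin NB → ℂ)
    (FA FB : Matrix (Fin NR) (Fin NR) ℂ) : ℝ :=
  (Matrix.trace
    (Matrix.vecMulVec (FA *ᵥ (HA *ᵥ qA)) (star (FA *ᵥ (HA *ᵥ qA)))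
      + Matrix.vecMulVec (FB *ᵥ (HB *ᵥ qB)) (star (FB *ᵥ (HB *ᵥ qB)))
      + FA * FAᴴ + FB * FBᴴ)).re

/-- The SINR term `sᴴ Fᴴ Gᴴ (G (F_A F_Aᴴ + F_B F_Bᴴ) Gᴴ + I)⁻¹ G F s` of the
three-phase scheme, where `s` is the received signal direction and `F` the relay matrix
carrying it. -/
noncomputable def sinr3P {NR Nr : ℕ}
    (G : Matrix (Fin Nr) (Fin NR) ℂ) (s : Fin NR → ℂ)
    (FA FB F : Matrix (Fin NR) (Fin NR) ℂ) : ℝ :=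
  (star (G *ᵥ (F *ᵥ s)) ⬝ᵥ
    ((G * (FA * FAᴴ + FB * FBᴴ) * Gᴴ + 1)⁻¹ *ᵥ (G *ᵥ (F *ᵥ s)))).re

namespace Matrix

open scoped ComplexOrder

/-- The orthogonal projection onto the line spanned by a nonzero complex vector. -/
theorem isStarProjection_inv_smul_vecMulVec_star {n : Type*} [Fintype n] {s : n → ℂ}
    (hs : s ≠ 0) :
    IsStarProjection ((star s ⬝ᵥ s)⁻¹ • vecMulVec s (star s)) := by
  have h0 : star s ⬝ᵥ s ≠ 0 := by
    rwa [Ne, dotProduct_star_self_eq_zero]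
  refine ⟨?_, ?_⟩
  · rw [IsIdempotentElem, smul_mul_smul_comm, vecMulVec_mul_vecMulVec, vecMulVec_smul, smul_smul,
      mul_assoc, inv_mul_cancel₀ h0, mul_one]
  · rw [isSelfAdjoint_iff, star_eq_conjTranspose, conjTranspose_smul, conjTranspose_vecMulVec,
      star_star, star_inv₀, ← star_dotProduct]

theorem inv_smul_vecMulVec_star_mulVec_self {n : Type*} [Fintype n] {s : n → ℂ} (hs : s ≠ 0) :
    ((star s ⬝ᵥ s)⁻¹ • vecMulVec s (star s)) *ᵥ s = s := by
  rw [smul_mulVec, vecMulVec_mulVec, op_smul_eq_smul, smul_smul,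
    inv_mul_cancel₀ (by rwa [Ne, dotProduct_star_self_eq_zero]), one_smul]

/-- A matrix `V` with orthonormal columns makes `V Vᴴ` an orthogonal projection. -/
theorem isStarProjection_mul_conjTranspose {m n : Type*} [Fintype m] [Fintype n] [DecidableEq n]
    {V : Matrix m n ℂ} (hV : Vᴴ * V = 1) : IsStarProjection (V * Vᴴ) := by
  refine ⟨?_, isHermitian_mul_conjTranspose_self V⟩
  rw [IsIdempotentElem, Matrix.mul_assoc, ← Matrix.mul_assoc Vᴴ, hV, Matrix.one_mul]

theorem posSemidef_of_isStarProjection {n : Type*} [Fintype n] {P : Matrix n n ℂ}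
    (hP : IsStarProjection P) : P.PosSemidef := by
  have h := posSemidef_conjTranspose_mul_self P
  rwa [← star_eq_conjTranspose, hP.isSelfAdjoint.star_eq, hP.isIdempotentElem.eq] at h

/-- Compressing by an orthogonal projection does not increase the trace of a positive
semidefinite matrix. -/
theorem re_trace_mul_mul_le_of_isStarProjection {n : Type*} [Fintype n] [DecidableEq n]
    {P M : Matrix n n ℂ} (hP : IsStarProjection P) (hM : M.PosSemidef) :
    (P * M * P).trace.re ≤ M.trace.re := by
  have hQ := hP.one_sub
  have h := (hM.mul_mul_conjTranspose_same (1 - P)).trace_nonneg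
  rw [← star_eq_conjTranspose, hQ.isSelfAdjoint.star_eq, trace_mul_cycle,
    hQ.isIdempotentElem.eq, Matrix.sub_mul, Matrix.one_mul, trace_sub] at h
  rw [trace_mul_cycle, hP.isIdempotentElem.eq]
  simpa using (Complex.le_def.1 h).1

/-- A Gram matrix `F Fᴴ` dominates `(F Q) (F Q)ᴴ` for every orthogonal projection `Q`. -/
theorem posSemidef_mul_conjTranspose_sub_of_isStarProjection {m n : Type*} [Fintype m] [Fintype n]
    [DecidableEq n] (F : Matrix m n ℂ) {Q : Matrix n n ℂ} (hQ : IsStarProjection Q) :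
    (F * Fᴴ - F * Q * (F * Q)ᴴ).PosSemidef := by
  have h := (posSemidef_of_isStarProjection hQ.one_sub).mul_mul_conjTranspose_same F
  have hQQ : F * Q * (F * Q)ᴴ = F * Q * Fᴴ := by
    rw [conjTranspose_mul, ← star_eq_conjTranspose Q, hQ.isSelfAdjoint.star_eq,
      ← Matrix.mul_assoc, Matrix.mul_assoc F, hQ.isIdempotentElem.eq]
  rwa [hQQ, ← Matrix.sub_mul, ← Matrix.mul_one F, Matrix.mul_assoc F, Matrix.one_mul,
    ← Matrix.mul_sub, Matrix.mul_one]

/-- Compressing `F` on both sides by orthogonal projections does not increase the trace of the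
Gram matrix `F Fᴴ`. -/
theorem re_trace_compression_mul_conjTranspose_le {n : Type*} [Fintype n] [DecidableEq n]
    (F : Matrix n n ℂ) {P Q : Matrix n n ℂ} (hP : IsStarProjection P) (hQ : IsStarProjection Q) :
    (P * F * Q * (P * F * Q)ᴴ).trace.re ≤ (F * Fᴴ).trace.re := by
  have h1 := re_trace_mul_mul_le_of_isStarProjection hP
    (posSemidef_self_mul_conjTranspose (F * Q))
  have h2 := (posSemidef_mul_conjTranspose_sub_of_isStarProjection F hQ).trace_nonneg
  rw [trace_sub] at h2
  have h3 := (Complex.le_def.1 h2).1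
  have h4 : P * F * Q * (P * F * Q)ᴴ = P * (F * Q * (F * Q)ᴴ) * P := by
    rw [Matrix.mul_assoc P F Q, conjTranspose_mul P, ← star_eq_conjTranspose P,
      hP.isSelfAdjoint.star_eq]
    simp only [Matrix.mul_assoc]
  simp only [Complex.zero_re, Complex.sub_re] at h3
  rw [h4]
  linarith

theorem re_trace_vecMulVec_mulVec_le_of_isStarProjection {n : Type*} [Fintype n] [DecidableEq n]
    {P : Matrix n n ℂ} (hP : IsStarProjection P) (v : n → ℂ) :
    (vecMulVec (P *ᵥ v) (star (P *ᵥ v))).trace.re ≤ (vecMulVec v (star v)).trace.re := by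
  have h : vecMulVec (P *ᵥ v) (star (P *ᵥ v)) = P * vecMulVec v (star v) * P := by
    rw [mul_vecMulVec, vecMulVec_mul, star_mulVec, ← star_eq_conjTranspose,
      hP.isSelfAdjoint.star_eq]
  rw [h]
  exact re_trace_mul_mul_le_of_isStarProjection hP (posSemidef_vecMulVec_self_star v)

/-- Inversion is antitone for the Loewner order on positive definite matrices. -/
theorem PosDef.posSemidef_inv_sub_inv {n : Type*} [Fintype n] [DecidableEq n]
    {A B : Matrix n n ℂ} (hA : A.PosDef) (hAB : (B - A).PosSemidef) :
    (A⁻¹ - B⁻¹).PosSemidef := by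
  have hB : B.PosDef := by simpa using hA.add_posSemidef hAB
  have hAu := (isUnit_iff_isUnit_det _).1 hA.isUnit
  have hBu := (isUnit_iff_isUnit_det _).1 hB.isUnit
  have h1 := hAB.conjTranspose_mul_mul_same B⁻¹
  have h2 := hA.inv.posSemidef.conjTranspose_mul_mul_same ((B - A) * B⁻¹)
  have h := h1.add h2
  rw [conjTranspose_mul, hB.inv.isHermitian.eq, hAB.isHermitian.eq] at h
  convert h using 1
  simp only [Matrix.mul_sub, Matrix.sub_mul, Matrix.mul_assoc, nonsing_inv_mul _ hBu,
    mul_nonsing_inv _ hBu, mul_nonsing_inv _ hAu, nonsing_inv_mul_cancel_left _ _ hAu,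
    Matrix.mul_one, Matrix.one_mul]
  abel

/-- If the range of `Gᴴ` is contained in the range of a matrix `V` with orthonormal columns,
then `G` absorbs the projection `V Vᴴ`. -/
theorem mul_mul_conjTranspose_eq_self_of_range_le {l m n : Type*} [Fintype l] [DecidableEq l]
    [Fintype m] [DecidableEq m] [Fintype n] [DecidableEq n]
    {G : Matrix l m ℂ} {V : Matrix m n ℂ} (hV : Vᴴ * V = 1)
    (hG : LinearMap.range (toEuclideanLin Gᴴ) ≤ LinearMap.range (toEuclideanLin V)) :
    G * (V * Vᴴ) = G := by
  have h : V * Vᴴ * Gᴴ = Gᴴ := by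
    refine ext_of_mulVec_single fun j ↦ ?_
    obtain ⟨w, hw⟩ := hG ⟨WithLp.toLp 2 (Pi.single j 1), rfl⟩
    have hw' : V *ᵥ w.ofLp = Gᴴ *ᵥ Pi.single j 1 := by
      simpa using congrArg WithLp.ofLp hw
    rw [← mulVec_mulVec, ← hw', mulVec_mulVec, Matrix.mul_assoc, hV, Matrix.mul_one]
  simpa using congrArg conjTranspose h

end Matrix

theorem evnorm_mul_self {m : ℕ} (v : Fin m → ℂ) :
    (evnorm v : ℂ) * evnorm v = star v ⬝ᵥ v := by
  rw [← Complex.ofReal_mul, evnorm, Real.mul_self_sqrt (by positivity)]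
  simp [dotProduct, Complex.conj_mul']

/-- The structured beamformer built from `a = Vᴴ F s / ‖s‖` is the two-sided compression of `F`
by the projection `V Vᴴ` and the projection onto the line of `s`. -/
theorem inv_evnorm_smul_vecMulVec_eq_compression {m k : ℕ} (V : Matrix (Fin m) (Fin k) ℂ)
    (F : Matrix (Fin m) (Fin m) ℂ) (s : Fin m → ℂ) :
    (evnorm s : ℂ)⁻¹ • vecMulVec (V *ᵥ ((evnorm s : ℂ)⁻¹ • Vᴴ *ᵥ (F *ᵥ s))) (star s)
      = V * Vᴴ * F * ((star s ⬝ᵥ s)⁻¹ • vecMulVec s (star s)) := by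
  rw [← evnorm_mul_self, mulVec_smul, smul_vecMulVec, smul_smul, ← mul_inv, Matrix.mul_smul,
    mul_vecMulVec, mulVec_mulVec, mulVec_mulVec, Matrix.mul_assoc V]

open scoped ComplexOrder in
theorem sinr3P_le_sinr3P {NR Nr : ℕ} {G : Matrix (Fin Nr) (Fin NR) ℂ} {s : Fin NR → ℂ}
    {FA FB F FA' FB' F' : Matrix (Fin NR) (Fin NR) ℂ}
    (hF : G *ᵥ (F' *ᵥ s) = G *ᵥ (F *ᵥ s))
    (hA : (G * FA * (G * FA)ᴴ - G * FA' * (G * FA')ᴴ).PosSemidef)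
    (hB : (G * FB * (G * FB)ᴴ - G * FB' * (G * FB')ᴴ).PosSemidef) :
    sinr3P G s FA FB F ≤ sinr3P G s FA' FB' F' := by
  have expand (X Y : Matrix (Fin NR) (Fin NR) ℂ) :
      G * (X * Xᴴ + Y * Yᴴ) * Gᴴ = G * X * (G * X)ᴴ + G * Y * (G * Y)ᴴ := by
    simp only [conjTranspose_mul, Matrix.mul_add, Matrix.add_mul, Matrix.mul_assoc]
  have hpos : (G * FA' * (G * FA')ᴴ + G * FB' * (G * FB')ᴴ + 1).PosDef :=
    PosDef.posSemidef_add ((posSemidef_self_mul_conjTranspose _).add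
      (posSemidef_self_mul_conjTranspose _)) PosDef.one
  have hle : ((G * FA * (G * FA)ᴴ + G * FB * (G * FB)ᴴ + 1)
      - (G * FA' * (G * FA')ᴴ + G * FB' * (G * FB')ᴴ + 1)).PosSemidef := by
    convert hA.add hB using 1
    abel
  have h := (hpos.posSemidef_inv_sub_inv hle).dotProduct_mulVec_nonneg (G *ᵥ (F *ᵥ s))
  rw [sub_mulVec, dotProduct_sub] at h
  rw [sinr3P, sinr3P, hF, expand, expand]
  simpa using (Complex.le_def.1 h).1

/-- Compressing the relay matrices onto a subspace seen by the receiver, and onto the lines of the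
received signals, does not decrease an SINR term. -/
theorem sinr3P_le_sinr3P_compression {NR Nr : ℕ} {G : Matrix (Fin Nr) (Fin NR) ℂ}
    {P QA QB Q : Matrix (Fin NR) (Fin NR) ℂ} {s : Fin NR → ℂ} (hG : G * P = G)
    (hQA : IsStarProjection QA) (hQB : IsStarProjection QB) (hs : Q *ᵥ s = s)
    (FA FB F : Matrix (Fin NR) (Fin NR) ℂ) :
    sinr3P G s FA FB F ≤ sinr3P G s (P * FA * QA) (P * FB * QB) (P * F * Q) := by
  have absorb (X Y : Matrix (Fin NR) (Fin NR) ℂ) : G * (P * X * Y) = G * X * Y := by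
    rw [← Matrix.mul_assoc, ← Matrix.mul_assoc, hG]
  apply sinr3P_le_sinr3P
  · rw [mulVec_mulVec, absorb, ← mulVec_mulVec, hs, mulVec_mulVec]
  · rw [absorb]
    exact posSemidef_mul_conjTranspose_sub_of_isStarProjection _ hQA
  · rw [absorb]
    exact posSemidef_mul_conjTranspose_sub_of_isStarProjection _ hQB

theorem relayPower3P_compression_le {NA NB NR : ℕ}
    {HA : Matrix (Fin NR) (Fin NA) ℂ} {HB : Matrix (Fin NR) (Fin NB) ℂ}
    {qA : Fin NA → ℂ} {qB : Fin NB → ℂ} {P QA QB : Matrix (Fin NR) (Fin NR) ℂ}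
    (hP : IsStarProjection P) (hQA : IsStarProjection QA) (hQB : IsStarProjection QB)
    (hA : QA *ᵥ (HA *ᵥ qA) = HA *ᵥ qA) (hB : QB *ᵥ (HB *ᵥ qB) = HB *ᵥ qB)
    (FA FB : Matrix (Fin NR) (Fin NR) ℂ) :
    relayPower3P HA HB qA qB (P * FA * QA) (P * FB * QB) ≤ relayPower3P HA HB qA qB FA FB := by
  have hA' : (P * FA * QA) *ᵥ (HA *ᵥ qA) = P *ᵥ (FA *ᵥ (HA *ᵥ qA)) := by
    rw [← mulVec_mulVec, hA, mulVec_mulVec _ P]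
  have hB' : (P * FB * QB) *ᵥ (HB *ᵥ qB) = P *ᵥ (FB *ᵥ (HB *ᵥ qB)) := by
    rw [← mulVec_mulVec, hB, mulVec_mulVec _ P]
  rw [relayPower3P, relayPower3P, hA', hB']
  simp only [trace_add, Complex.add_re]
  exact add_le_add (add_le_add (add_le_add
    (re_trace_vecMulVec_mulVec_le_of_isStarProjection hP _)
    (re_trace_vecMulVec_mulVec_le_of_isStarProjection hP _))
    (re_trace_compression_mul_conjTranspose_le _ hP hQA))
    (re_trace_compression_mul_conjTranspose_le _ hP hQB)

/-- **Lemma 2 of the paper.** For every pair of relay matrices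
`(F_A, F_B)` there exist vectors `a₁, a₂` such that the structured matrices
`F_A' = V a₁ (H_A q_A)ᴴ/‖H_A q_A‖` and `F_B' = V a₂ (H_B q_B)ᴴ/‖H_B q_B‖` use no more
relay power while achieving SINR terms `x_{BA}` and `x_{AB}` at least as large. -/
theorem relay_beamformer_structure_3P
    {NA NB NR kV : ℕ}
    (GA : Matrix (Fin NA) (Fin NR) ℂ) (GB : Matrix (Fin NB) (Fin NR) ℂ)
    (HA : Matrix (Fin NR) (Fin NA) ℂ) (HB : Matrix (Fin NR) (Fin NB) ℂ)
    (qA : Fin NA → ℂ) (qB : Fin NB → ℂ)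
    (hA : HA *ᵥ qA ≠ 0) (hB : HB *ᵥ qB ≠ 0)
    (V : Matrix (Fin NR) (Fin kV) ℂ) (hV : Vᴴ * V = 1)
    (hVspan : LinearMap.range (Matrix.toEuclideanLin V)
        = LinearMap.range (Matrix.toEuclideanLin GAᴴ)
          ⊔ LinearMap.range (Matrix.toEuclideanLin GBᴴ)) :
    ∀ FA FB : Matrix (Fin NR) (Fin NR) ℂ,
      ∃ a₁ a₂ : Fin kV → ℂ,
        let FA' : Matrix (Fin NR) (Fin NR) ℂ :=
          ((evnorm (HA *ᵥ qA) : ℂ))⁻¹ • Matrix.vecMulVec (V *ᵥ a₁) (star (HA *ᵥ qA));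
        let FB' : Matrix (Fin NR) (Fin NR) ℂ :=
          ((evnorm (HB *ᵥ qB) : ℂ))⁻¹ • Matrix.vecMulVec (V *ᵥ a₂) (star (HB *ᵥ qB));
        relayPower3P HA HB qA qB FA' FB' ≤ relayPower3P HA HB qA qB FA FB ∧
        sinr3P GA (HB *ᵥ qB) FA FB FB ≤ sinr3P GA (HB *ᵥ qB) FA' FB' FB' ∧
        sinr3P GB (HA *ᵥ qA) FA FB FA ≤ sinr3P GB (HA *ᵥ qA) FA' FB' FA' := by
  intro FA FB
  have hP := isStarProjection_mul_conjTranspose hV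
  have hGA : GA * (V * Vᴴ) = GA :=
    mul_mul_conjTranspose_eq_self_of_range_le hV (hVspan ▸ le_sup_left)
  have hGB : GB * (V * Vᴴ) = GB :=
    mul_mul_conjTranspose_eq_self_of_range_le hV (hVspan ▸ le_sup_right)
  have hQA := isStarProjection_inv_smul_vecMulVec_star hA
  have hQB := isStarProjection_inv_smul_vecMulVec_star hB
  refine ⟨(evnorm (HA *ᵥ qA) : ℂ)⁻¹ • Vᴴ *ᵥ (FA *ᵥ (HA *ᵥ qA)),
    (evnorm (HB *ᵥ qB) : ℂ)⁻¹ • Vᴴ *ᵥ (FB *ᵥ (HB *ᵥ qB)), ?_⟩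
  intro FA' FB'
  have hFA' := inv_evnorm_smul_vecMulVec_eq_compression V FA (HA *ᵥ qA)
  have hFB' := inv_evnorm_smul_vecMulVec_eq_compression V FB (HB *ᵥ qB)
  change FA' = _ at hFA'
  change FB' = _ at hFB'
  rw [hFA', hFB']
  exact ⟨relayPower3P_compression_le hP hQA hQB (inv_smul_vecMulVec_star_mulVec_self hA)
      (inv_smul_vecMulVec_star_mulVec_self hB) FA FB,
    sinr3P_le_sinr3P_compression hGA hQA hQB (inv_smul_vecMulVec_star_mulVec_self hB) FA FB FB,
    sinr3P_le_sinr3P_compression hGB hQA hQB (inv_smul_vecMulVec_star_mulVec_self hA) FA FB FA⟩
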